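/- In su_q^P(3) the deformed third-order Casimir function D_z^P = −(1/z³)sinh(z(h₁+h₂−2h₃)/3)sinh(z(h₁+h₃−2h₂)/3)sinh(z(h₂+h₃−2h₁)/3) + (1/z)a₁₂a₂₁sinh(z(h₁+h₂−2h₃)/3) + (1/z)a₂₃a₃₂sinh(z(h₂+h₃−2h₁)/3) + (1/z)a₃₁a₁₃sinh(z(h₃+h₁−2h₂)/3) + (a₁₂a₂₃a₃₁ + a₂₁a₃₂a₁₃)cosh(z(h₃+h₁−2h₂)/3) + z·a₁₂a₂₁a₃₂a₂₃sinh(z(h₃+h₁−2h₂)/3) is a Casimir: for every smooth function f : ℝ⁹ → ℝ, {D_z^P, f} = 0. -/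

import Mathlib

/-- Partial derivative of a function on ℝ⁹ in the `i`-th coordinate direction.
Coordinates: (x 0,…,x 8) = (h₁,h₂,h₃,a₁₂,a₂₁,a₂₃,a₃₂,a₁₃,a₃₁). -/
noncomputable def pd (i : Fin 9) (f : (Fin 9 → ℝ) → ℝ) (x : Fin 9 → ℝ) : ℝ :=
  fderiv ℝ f x (Pi.single i 1)

/-- The structure functions π(u,v) of su_q^P(3) for u < v (zero otherwise);
indices: 0=h₁, 1=h₂, 2=h₃, 3=a₁₂, 4=a₂₁, 5=a₂₃, 6=a₃₂, 7=a₁₃, 8=a₃₁. -/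
noncomputable def piU (z : ℝ) (u v : ℕ) (x : Fin 9 → ℝ) : ℝ :=
  match u, v with
  | 0, 3 => x 3
  | 0, 4 => -x 4
  | 0, 7 => x 7
  | 0, 8 => -x 8
  | 1, 3 => -x 3
  | 1, 4 => x 4
  | 1, 5 => x 5
  | 1, 6 => -x 6
  | 2, 5 => -x 5
  | 2, 6 => x 6
  | 2, 7 => -x 7
  | 2, 8 => x 8
  | 3, 4 => Real.sinh (z * (x 0 - x 1)) / z
  | 3, 5 => x 7
  | 3, 7 => z ^ 2 * x 3 ^ 2 * x 5
  | 3, 8 => -(Real.cosh (z * (x 0 - x 1)) * x 6)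
  | 4, 6 => -x 8
  | 4, 7 => Real.cosh (z * (x 0 - x 1)) * x 5
  | 4, 8 => -(z ^ 2 * x 4 ^ 2 * x 6)
  | 5, 6 => Real.sinh (z * (x 1 - x 2)) / z
  | 5, 7 => -(z ^ 2 * x 5 ^ 2 * x 3)
  | 5, 8 => Real.cosh (z * (x 1 - x 2)) * x 4
  | 6, 7 => -(Real.cosh (z * (x 1 - x 2)) * x 3)
  | 6, 8 => z ^ 2 * x 6 ^ 2 * x 4
  | 7, 8 => Real.sinh (z * (x 0 - x 2)) / z
      + z * Real.sinh (z * (x 0 - x 1)) * x 5 * x 6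
      + z * Real.sinh (z * (x 1 - x 2)) * x 3 * x 4
  | _, _ => 0

/-- The bracket of the q-Poisson algebra su_q^P(3):
{f,g} = Σ_{u<v} π(u,v)(∂_u f ∂_v g − ∂_v f ∂_u g). -/
noncomputable def suq3Bracket (z : ℝ) (f g : (Fin 9 → ℝ) → ℝ) (x : Fin 9 → ℝ) : ℝ :=
  ∑ u : Fin 9, ∑ v : Fin 9,
    if u < v then piU z u.val v.val x * (pd u f x * pd v g x - pd v f x * pd u g x)
    else 0

/-- The deformed third-order Casimir function D_z^P of su_q^P(3). -/
noncomputable def suq3Casimir3 (z : ℝ) (x : Fin 9 → ℝ) : ℝ :=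
  -(1 / z ^ 3) *
      (Real.sinh (z * (x 0 + x 1 - 2 * x 2) / 3)
       * Real.sinh (z * (x 0 + x 2 - 2 * x 1) / 3)
       * Real.sinh (z * (x 1 + x 2 - 2 * x 0) / 3))
  + (1 / z) * x 3 * x 4 * Real.sinh (z * (x 0 + x 1 - 2 * x 2) / 3)
  + (1 / z) * x 5 * x 6 * Real.sinh (z * (x 1 + x 2 - 2 * x 0) / 3)
  + (1 / z) * x 8 * x 7 * Real.sinh (z * (x 2 + x 0 - 2 * x 1) / 3)
  + (x 3 * x 5 * x 8 + x 4 * x 6 * x 7) * Real.cosh (z * (x 2 + x 0 - 2 * x 1) / 3)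
  + z * x 3 * x 4 * x 6 * x 5 * Real.sinh (z * (x 2 + x 0 - 2 * x 1) / 3)

/-- The directional derivative of `suq3Casimir3 z` at `x` along `v`. -/
lemma fderiv_suq3Casimir3_apply (z : ℝ) (x v : Fin 9 → ℝ) :
    fderiv ℝ (suq3Casimir3 z) x v =
      let p := z * (x 0 + x 1 - 2 * x 2) / 3
      let q := z * (x 0 + x 2 - 2 * x 1) / 3
      let r := z * (x 1 + x 2 - 2 * x 0) / 3
      let p' := z * (v 0 + v 1 - 2 * v 2) / 3
      let q' := z * (v 0 + v 2 - 2 * v 1) / 3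
      let r' := z * (v 1 + v 2 - 2 * v 0) / 3;
      -(1 / z ^ 3) * (Real.cosh p * p' * Real.sinh q * Real.sinh r
          + Real.sinh p * (Real.cosh q * q') * Real.sinh r
          + Real.sinh p * Real.sinh q * (Real.cosh r * r'))
        + 1 / z * ((v 3 * x 4 + x 3 * v 4) * Real.sinh p + x 3 * x 4 * (Real.cosh p * p'))
        + 1 / z * ((v 5 * x 6 + x 5 * v 6) * Real.sinh r + x 5 * x 6 * (Real.cosh r * r'))
        + 1 / z * ((v 8 * x 7 + x 8 * v 7) * Real.sinh q + x 8 * x 7 * (Real.cosh q * q'))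
        + (v 3 * x 5 * x 8 + x 3 * v 5 * x 8 + x 3 * x 5 * v 8
            + v 4 * x 6 * x 7 + x 4 * v 6 * x 7 + x 4 * x 6 * v 7) * Real.cosh q
        + (x 3 * x 5 * x 8 + x 4 * x 6 * x 7) * (Real.sinh q * q')
        + z * (v 3 * x 4 * x 6 * x 5 + x 3 * v 4 * x 6 * x 5 + x 3 * x 4 * v 6 * x 5
            + x 3 * x 4 * x 6 * v 5) * Real.sinh q
        + z * x 3 * x 4 * x 6 * x 5 * (Real.cosh q * q') := by
  have hx (i : Fin 9) : HasFDerivAt (fun y : Fin 9 → ℝ => y i)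
      (ContinuousLinearMap.proj (R := ℝ) (φ := fun _ : Fin 9 => ℝ) i) x := hasFDerivAt_apply i x
  have harg (i j k : Fin 9) := (((hx i).add (hx j)).sub ((hx k).const_mul 2)).const_mul z |>.mul_const 3⁻¹
  have hp := harg 0 1 2
  have hq := harg 0 2 1
  have hq₂ := harg 2 0 1
  have hr := harg 1 2 0
  have h := ((((((hp.sinh.mul hq.sinh).mul hr.sinh).const_mul (-(1 / z ^ 3))).add
    ((((hx 3).const_mul (1 / z)).mul (hx 4)).mul hp.sinh)).add
    ((((hx 5).const_mul (1 / z)).mul (hx 6)).mul hr.sinh)).add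
    ((((hx 8).const_mul (1 / z)).mul (hx 7)).mul hq₂.sinh)).add
    (((((hx 3).mul (hx 5)).mul (hx 8)).add (((hx 4).mul (hx 6)).mul (hx 7))).mul hq₂.cosh) |>.add
    ((((((hx 3).const_mul z).mul (hx 4)).mul (hx 6)).mul (hx 5)).mul hq₂.sinh)
  have h' : HasFDerivAt (suq3Casimir3 z) _ x := h
  rw [h'.fderiv]
  simp only [add_apply, sub_apply,
    smul_apply, ContinuousLinearMap.proj_apply, smul_eq_mul,
    ← div_eq_mul_inv, add_comm (x 2) (x 0), Pi.add_apply, Pi.mul_apply, Pi.sub_apply]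
  ring

set_option maxHeartbeats 800000 in
/-- The Hamiltonian vector field of `suq3Casimir3 z` vanishes: the structure matrix annihilates
its gradient. -/
lemma sum_piU_mul_pd_suq3Casimir3 {z : ℝ} (hz : z ≠ 0) (x : Fin 9 → ℝ) (v : Fin 9) :
    ∑ u : Fin 9, (piU z u v x - piU z v u x) * pd u (suq3Casimir3 z) x = 0 := by
  obtain ⟨p, hp⟩ : ∃ p, p = z * (x 0 + x 1 - 2 * x 2) / 3 := ⟨_, rfl⟩
  obtain ⟨q, hq⟩ : ∃ q, q = z * (x 0 + x 2 - 2 * x 1) / 3 := ⟨_, rfl⟩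
  have hr : z * (x 1 + x 2 - 2 * x 0) / 3 = -(p + q) := by rw [hp, hq]; ring
  have h₁₂ : z * (x 0 - x 1) = p + q + q := by rw [hp, hq]; ring
  have h₂₃ : z * (x 1 - x 2) = p - q := by rw [hp, hq]; ring
  have h₁₃ : z * (x 0 - x 2) = p + (p + q) := by rw [hp, hq]; ring
  have hcq := Real.cosh_sq q
  have hcq₃ : Real.cosh q ^ 3 = Real.cosh q * (Real.sinh q ^ 2 + 1) := by rw [← hcq]; ring
  have hpd (u : Fin 9) := fderiv_suq3Casimir3_apply z x (Pi.single u 1)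
  simp only [← hp, ← hq, hr, Real.sinh_neg, Real.cosh_neg, Real.sinh_add, Real.cosh_add] at hpd
  simp only [Fin.sum_univ_succ, Fin.sum_univ_zero, pd, hpd]
  fin_cases v <;>
    simp [piU, h₁₂, h₂₃, h₁₃, Real.sinh_add, Real.cosh_add, Real.sinh_sub,
      Real.cosh_sub] <;>
    field_simp <;> ring_nf <;>
    simp only [hcq, hcq₃] <;> ring

/-- D_z^P is a Casimir function of su_q^P(3). -/
theorem suq3_casimir3 (z : ℝ) (hz : z ≠ 0)
    (f : (Fin 9 → ℝ) → ℝ) (hf : ContDiff ℝ (⊤ : ℕ∞) f) :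
    ∀ x : Fin 9 → ℝ, suq3Bracket z (suq3Casimir3 z) f x = 0 := by
  intro x
  have h : suq3Bracket z (suq3Casimir3 z) f x =
      ∑ v : Fin 9, pd v f x *
        ∑ u : Fin 9, (piU z u v x - piU z v u x) * pd u (suq3Casimir3 z) x := by
    simp only [suq3Bracket, Fin.sum_univ_succ, Fin.sum_univ_zero]
    simp [piU]
    ring
  rw [h]
  simp [sum_piU_mul_pd_suq3Casimir3 hz]
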